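/- Fix λ, μ1, μ2 > 0, p ∈ (0,1) and ρ > 0. For each μ3 > 0, set λe = ρ·μ3, and let (π(μ3), v(μ3)) be the unique solution of the balance equations with normalization π1+⋯+π8 = 1 together with the correlation equations (6a)–(6h), and let Δ(μ3) := v_{10}(μ3) + v_{20}(μ3) + ⋯ + v_{80}(μ3). Then as μ3 → ∞, Δ(μ3) converges to the closed-form mean-field average age of information Δ(λ,p,μ1,μ2,ρ) = ((1+ρ)/λ) · (λ³m1 + λ²m2 + λm3 + μ1μ2(μ1+μ2)(1+ρ)) / ((μ1 + λp(1+ρ) + μ1pρ) · (μ2(μ1+μ2)(1+ρ) + λp̄(μ1 + μ2(1+ρ)))), where p̄ = 1−p, m1 = (1+ρ)·p·p̄, m2 = μ2(1+ρ) + μ1(1 + (2−p)pρ), and m3 = (1+ρ)(μ1+μ2)² − μ1²·p̄·ρ. -/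

import Mathlib

/-- Left-hand sides of the eight balance equations of the finite-state Markov chain,
with states `π1,…,π8` indexed by `Fin 8` (so `π i` is `π_{i+1}`),
`a = λ + λe + μ1 + μ2 + μ3` and `â = a - μ1`. -/
def bLHS (lam lamE mu1 mu2 mu3 : ℝ) (π : Fin 8 → ℝ) : Fin 8 → ℝ :=
  let a := lam + lamE + mu1 + mu2 + mu3
  let ah := a - mu1
  ![a * π 0, a * π 1, a * π 2, ah * π 3, ah * π 4, ah * π 5, a * π 6, a * π 7]

/-- Right-hand sides of the eight balance equations, with `p̄ = 1 - p`. -/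
def bRHS (lam lamE mu1 mu2 mu3 p : ℝ) (π : Fin 8 → ℝ) : Fin 8 → ℝ :=
  let pb := 1 - p
  ![ (lam * pb + mu2 + mu3) * π 0 + lam * pb * (π 2 + π 3),
     (lam * pb + mu2 + mu3) * π 1 + lam * pb * π 4,
     (lam * p + mu2 + mu3) * π 2 + lam * p * (π 0 + π 1),
     (lam * p + mu2 + mu3) * π 3 + lam * p * π 4 + mu1 * (π 2 + π 7),
     (mu2 + mu3) * π 4 + mu1 * (π 0 + π 1 + π 6),
     (lam * p + lamE + mu2 + mu3) * π 5 + lamE * (π 3 + π 4),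
     (lam * pb + lamE + mu2 + mu3) * π 6 + lamE * (π 0 + π 1) + lam * pb * (π 5 + π 7),
     (lam * p + lamE + mu2 + mu3) * π 7 + lamE * π 2 + lam * p * π 6 ]

/-- The thirty-two correlation equations (6a)–(6h): `v s k` is the correlation `v_{(s+1),k}`
for state `s+1` and age component `k ∈ {0,1,2,3}`; `u = (1,1,1,1)`, `û = (1,0,1,1)`. -/
def corrEq (lam lamE mu1 mu2 mu3 p : ℝ) (π : Fin 8 → ℝ) (v : Fin 8 → Fin 4 → ℝ) : Prop :=
  let a := lam + lamE + mu1 + mu2 + mu3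
  let ah := a - mu1
  let pb := 1 - p
  let u : Fin 4 → ℝ := ![1, 1, 1, 1]
  let uh : Fin 4 → ℝ := ![1, 0, 1, 1]
  -- (6a)
  (∀ k : Fin 4, a * v 0 k = u k * π 0
      + lam * pb * ![v 0 0, 0, v 0 2, v 0 3] k
      + mu2 * ![v 0 2, v 0 1, v 0 2, v 0 2] k
      + mu3 * ![v 0 3, v 0 1, v 0 2, v 0 3] k
      + lam * pb * ![v 2 0, 0, v 2 2, v 2 3] k
      + lam * pb * ![v 3 0, 0, v 3 2, v 3 3] k) ∧
  -- (6b)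
  (∀ k : Fin 4, a * v 1 k = u k * π 1
      + lam * pb * ![v 1 0, 0, v 1 2, v 1 3] k
      + mu2 * ![v 1 2, v 1 1, v 1 2, v 1 3] k
      + mu3 * ![v 1 3, v 1 1, v 1 3, v 1 3] k
      + lam * pb * ![v 4 0, 0, v 4 2, v 4 3] k) ∧
  -- (6c)
  (∀ k : Fin 4, a * v 2 k = u k * π 2
      + lam * p * ![v 2 0, v 2 1, 0, v 2 3] k
      + mu2 * ![v 2 2, v 2 2, v 2 2, v 2 2] k
      + mu3 * ![v 2 3, v 2 1, v 2 2, v 2 3] k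
      + lam * p * ![v 0 0, v 0 1, 0, v 0 3] k
      + lam * p * ![v 1 0, v 1 1, 0, v 1 3] k) ∧
  -- (6d)
  (∀ k : Fin 4, ah * v 3 k = uh k * π 3
      + lam * p * (![v 3 0, 0, 0, v 3 3] k + ![v 4 0, 0, 0, v 4 3] k)
      + mu2 * ![v 3 2, 0, v 3 2, v 3 2] k
      + mu3 * ![v 3 3, 0, v 3 2, v 3 3] k
      + mu1 * (![v 2 0, 0, v 2 2, v 2 1] k + ![v 7 0, 0, v 7 2, v 7 1] k)) ∧
  -- (6e)
  (∀ k : Fin 4, ah * v 4 k = uh k * π 4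
      + mu1 * ![v 6 0, 0, v 6 2, v 6 1] k
      + mu2 * ![v 4 2, 0, v 4 2, v 4 3] k
      + mu3 * ![v 4 3, 0, v 4 3, v 4 3] k
      + mu1 * ![v 0 0, 0, v 0 2, v 0 1] k
      + mu1 * ![v 1 0, 0, v 1 2, v 1 1] k) ∧
  -- (6f)
  (∀ k : Fin 4, ah * v 5 k = uh k * π 5
      + lam * p * ![v 5 0, 0, 0, v 5 3] k
      + lamE * (![v 3 0, 0, v 3 2, v 3 0] k + ![v 4 0, 0, v 4 2, v 4 0] k
          + ![v 5 0, 0, v 5 2, v 5 0] k)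
      + mu2 * ![v 5 2, 0, v 5 2, v 5 2] k
      + mu3 * ![v 5 3, 0, v 5 2, v 5 3] k) ∧
  -- (6g)
  (∀ k : Fin 4, a * v 6 k = u k * π 6
      + lam * pb * ![v 5 0, 0, v 5 2, v 5 3] k
      + lam * pb * ![v 6 0, 0, v 6 2, v 6 3] k
      + lam * pb * ![v 7 0, 0, v 7 2, v 7 3] k
      + lamE * ![v 0 0, v 0 1, v 0 2, v 0 0] k
      + lamE * ![v 1 0, v 1 1, v 1 2, v 1 0] k
      + lamE * ![v 6 0, v 6 1, v 6 2, v 6 0] k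
      + mu3 * ![v 6 3, v 6 1, v 6 2, v 6 3] k
      + mu2 * ![v 6 2, v 6 1, v 6 2, v 6 2] k) ∧
  -- (6h)
  (∀ k : Fin 4, a * v 7 k = u k * π 7
      + lam * p * ![v 6 0, v 6 1, 0, v 6 3] k
      + lamE * ![v 2 0, v 2 1, v 2 2, v 2 0] k
      + lamE * ![v 7 0, v 7 1, v 7 2, v 7 0] k
      + mu2 * ![v 7 2, v 7 2, v 7 2, v 7 2] k
      + mu3 * ![v 7 3, v 7 1, v 7 2, v 7 3] k
      + lam * p * ![v 7 0, v 7 1, 0, v 7 3] k)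


/-- The closed-form mean-field average age of information `Δ(λ, p, μ1, μ2, ρ)` of eq. (7). -/
noncomputable def mfAoI (lam p mu1 mu2 rho : ℝ) : ℝ :=
  let pb := 1 - p
  let m1 := (1 + rho) * p * pb
  let m2 := mu2 * (1 + rho) + mu1 * (1 + (2 - p) * p * rho)
  let m3 := (1 + rho) * (mu1 + mu2) ^ 2 - mu1 ^ 2 * pb * rho
  ((1 + rho) / lam) *
    (lam ^ 3 * m1 + lam ^ 2 * m2 + lam * m3 + mu1 * mu2 * (mu1 + mu2) * (1 + rho)) /
      ((mu1 + lam * p * (1 + rho) + mu1 * p * rho) *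
        (mu2 * (mu1 + mu2) * (1 + rho) + lam * pb * (mu1 + mu2 * (1 + rho))))

open Filter Topology in
theorem cr2 {a b c d e f x y : ℝ → ℝ} {a' b' c' d' e' f' : ℝ}
    (ha : Tendsto a atTop (𝓝 a')) (hb : Tendsto b atTop (𝓝 b'))
    (hc : Tendsto c atTop (𝓝 c')) (hd : Tendsto d atTop (𝓝 d'))
    (he : Tendsto e atTop (𝓝 e')) (hf : Tendsto f atTop (𝓝 f'))
    (hdet : a' * d' - b' * c' ≠ 0)
    (h1 : ∀ t, 0 < t → a t * x t + b t * y t = e t)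
    (h2 : ∀ t, 0 < t → c t * x t + d t * y t = f t) :
    Tendsto x atTop (𝓝 ((e' * d' - b' * f') / (a' * d' - b' * c'))) ∧
    Tendsto y atTop (𝓝 ((a' * f' - c' * e') / (a' * d' - b' * c'))) := by
  have hD := (ha.mul hd).sub (hb.mul hc)
  have hne := hD.eventually_ne hdet
  constructor
  · refine (((he.mul hd).sub (hb.mul hf)).div hD hdet).congr' ?_
    filter_upwards [hne, eventually_gt_atTop 0] with t ht h0
    simp only [Pi.div_apply, Pi.mul_apply, Pi.sub_apply]
    rw [div_eq_iff ht]
    linear_combination -(d t) * h1 t h0 + b t * h2 t h0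
  · refine (((ha.mul hf).sub (hc.mul he)).div hD hdet).congr' ?_
    filter_upwards [hne, eventually_gt_atTop 0] with t ht h0
    simp only [Pi.div_apply, Pi.mul_apply, Pi.sub_apply]
    rw [div_eq_iff ht]
    linear_combination c t * h1 t h0 - (a t) * h2 t h0

open Filter Topology in
theorem sm {n x : ℝ → ℝ} {n' c k : ℝ} (hk : 0 < k)
    (hn : Tendsto n atTop (𝓝 n'))
    (h : ∀ t, 0 < t → (c + k * t) * x t = n t) :
    Tendsto (fun t => t * x t) atTop (𝓝 (n' / k)) ∧ Tendsto x atTop (𝓝 0) := by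
  have hi : Tendsto (fun t : ℝ => t⁻¹) atTop (𝓝 0) := tendsto_inv_atTop_zero
  have hd : Tendsto (fun t : ℝ => c * t⁻¹ + k) atTop (𝓝 k) := by
    simpa using (hi.const_mul c).add_const k
  have h1 : Tendsto (fun t => t * x t) atTop (𝓝 (n' / k)) := by
    refine (hn.div hd hk.ne').congr' ?_
    filter_upwards [hd.eventually_ne hk.ne', eventually_gt_atTop 0] with t ht h0
    simp only [Pi.div_apply]
    rw [div_eq_iff ht, ← h t h0]
    field_simp
  refine ⟨h1, ?_⟩
  have h2 := hi.mul h1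
  rw [zero_mul] at h2
  refine h2.congr' ?_
  filter_upwards [eventually_gt_atTop 0] with t h0
  field_simp

theorem ptw (l m n p e t : ℝ) (hl : 0 < l) (hm : 0 < m) (hn : 0 < n) (hp : 0 < p) (hp1 : p < 1)
    (he : 0 < e) (ht : 0 < t) (A B C A1 B1 B2 : ℝ) (π : Fin 8 → ℝ) (v : Fin 8 → Fin 4 → ℝ)
    (hA : (l + m) * A = l * (1 - p)) (hB : (l * (1 - p) + m) * B = l * p * A) (hC : C = 1 - A - B)
    (hA1 : (l + m) * A1 = A) (hB2 : (l + m) * B2 = B)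
    (hB1 : (l * (1 - p) + m + n) * B1 = B + n * B2 + l * p * A1)
    (hb : ∀ i : Fin 8, bLHS l e m n t π i = bRHS l e m n t p π i)
    (hs : ∑ i : Fin 8, π i = 1) (hv : corrEq l e m n t p π v) :
    -- probabilities
    π 0 + π 1 + π 6 = A ∧ π 2 + π 7 = B ∧ π 3 + π 4 + π 5 = C ∧
    (l + e) * π 4 = m * A ∧
    (l * p + m + e) * π 1 = l * (1 - p) * π 4 ∧
    (l * (1 - p) + e) * π 3 = l * p * π 4 + m * B ∧
    (m + e) * (π 0 + π 2) = l * (1 - p) * π 3 + l * p * π 1 ∧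
    -- component 1, 2, 3 small
    (l + e) * v 4 3 = π 4 + m * A1 ∧
    (l * p + m + e) * v 1 3 = π 1 + l * (1 - p) * v 4 3 ∧
    (l + e) * v 3 2 = π 3 + m * B2 ∧
    (l * (1 - p) + n + e) * v 3 3 = π 3 + l * p * v 4 3 + n * v 3 2 + m * B1 ∧
    (m + l * p + e) * (v 0 2 + v 2 2) = π 0 + π 2 + l * (1 - p) * v 3 2 ∧
    (m + n + e) * (v 0 3 + v 2 3) = π 0 + π 2 + l * (1 - p) * v 3 3 + l * p * v 1 3
      + n * (v 0 2 + v 2 2) ∧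
    -- component 2
    (l + e + t) * (v 4 2 - v 4 3)
      = m * ((v 0 2 + v 1 2 + v 6 2 + v 2 2 + v 7 2) - (A1 + B2)) ∧
    (l * p + m + e + t) * (v 1 2 - v 1 3) = l * (1 - p) * (v 4 2 - v 4 3) ∧
    (l * p + m) * (v 0 2 + v 1 2 + v 6 2 + v 2 2 + v 7 2) + t * (v 1 2 - v 1 3)
      = A + B + l * (1 - p) * (v 3 2 + v 4 2 + v 5 2) ∧
    l * (v 3 2 + v 4 2 + v 5 2) + t * (v 4 2 - v 4 3)
      = C + m * (v 0 2 + v 1 2 + v 6 2 + v 2 2 + v 7 2) ∧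
    -- component 0
    (m + n + t) * (v 0 0 + v 1 0 + v 6 0 + v 2 0 + v 7 0)
      = A + B + l * (1 - p) * (v 3 0 + v 4 0 + v 5 0)
        + n * (v 0 2 + v 1 2 + v 6 2 + v 2 2 + v 7 2)
        + t * (v 0 3 + v 2 3 + v 1 3 + (v 6 3 + v 7 3)) ∧
    (l * (1 - p) + n + t) * (v 3 0 + v 4 0 + v 5 0)
      = C + m * (v 0 0 + v 1 0 + v 6 0 + v 2 0 + v 7 0)
        + n * (v 3 2 + v 4 2 + v 5 2) + t * (v 3 3 + v 4 3 + v 5 3) ∧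
    (m + n + e) * (v 6 3 + v 7 3)
      = π 6 + π 7 + l * (1 - p) * v 5 3 + e * (v 0 0 + v 1 0 + v 6 0 + v 2 0 + v 7 0)
        + n * (v 6 2 + v 7 2) ∧
    (l * (1 - p) + n + e) * v 5 3 = π 5 + e * (v 3 0 + v 4 0 + v 5 0) + n * v 5 2 := by
  have b0 := hb 0
  have b1 := hb 1
  have b2 := hb 2
  have b3 := hb 3
  have b4 := hb 4
  have b5 := hb 5
  have b6 := hb 6
  have b7 := hb 7
  simp [bLHS, bRHS] at b0 b1 b2 b3 b4 b5 b6 b7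
  simp [Fin.sum_univ_succ] at hs
  obtain ⟨c0, c1, c2, c3, c4, c5, c6, c7⟩ := hv
  simp [Fin.forall_fin_succ] at c0 c1 c2 c3 c4 c5 c6 c7
  obtain ⟨w00, w01, w02, w03⟩ := c0
  obtain ⟨w10, w11, w12, w13⟩ := c1
  obtain ⟨w20, w21, w22, w23⟩ := c2
  obtain ⟨w30, w31, w32, w33⟩ := c3
  obtain ⟨w40, w41, w42, w43⟩ := c4
  obtain ⟨w50, w51, w52, w53⟩ := c5
  obtain ⟨w60, w61, w62, w63⟩ := c6
  obtain ⟨w70, w71, w72, w73⟩ := c7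

  have hq : 0 < 1 - p := by linarith
  have hlq : 0 < l * (1 - p) := mul_pos hl hq
  have hlm : l + m ≠ 0 := by positivity
  have qA : π 0 + π 1 + π 6 = A := by
    apply mul_left_cancel₀ hlm
    linear_combination b0 + b1 + b6 - hA + l * (1 - p) * hs
  have qB : π 2 + π 7 = B := by
    apply mul_left_cancel₀ (show l * (1 - p) + m ≠ 0 by positivity)
    linear_combination b2 + b7 - hB + l * p * qA
  have qC : π 3 + π 4 + π 5 = C := by linear_combination hs - qA - qB - hC
  have qA1 : v 0 1 + v 1 1 + v 6 1 = A1 := by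
    apply mul_left_cancel₀ hlm
    linear_combination w01 + w11 + w61 + qA - hA1
  have qB2 : v 2 2 + v 7 2 = B2 := by
    apply mul_left_cancel₀ hlm
    linear_combination w22 + w72 + qB - hB2
  have qB1 : v 2 1 + v 7 1 = B1 := by
    apply mul_left_cancel₀ (show l * (1 - p) + m + n ≠ 0 by positivity)
    linear_combination w21 + w71 + qB - hB1 + n * qB2 + l * p * qA1
  refine ⟨qA, qB, qC, ?_, ?_, ?_, ?_, ?_, ?_, ?_, ?_, ?_, ?_, ?_, ?_, ?_, ?_, ?_, ?_, ?_, ?_⟩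
  · linear_combination b4 + m * qA
  · linear_combination b1
  · linear_combination b3 + m * qB
  · linear_combination b0 + b2
  · linear_combination w43 + m * qA1
  · linear_combination w13
  · linear_combination w32 + m * qB2
  · linear_combination w33 + m * qB1
  · linear_combination w02 + w22
  · linear_combination w03 + w23
  · linear_combination w42 - w43 - m * qA1 - m * qB2
  · linear_combination w12 - w13
  · linear_combination w02 + w12 + w62 + w22 + w72 + qA + qB
  · linear_combination w32 + w42 + w52 + qC
  · linear_combination w00 + w10 + w60 + w20 + w70 + qA + qB
  · linear_combination w30 + w40 + w50 + qC
  · linear_combination w63 + w73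
  · linear_combination w53


/-- Fix `λ, μ1, μ2 > 0`, `p ∈ (0,1)` and `ρ > 0`. For each `μ3 > 0`, set `λe = ρ·μ3` and let
`(π(μ3), v(μ3))` be the unique solution of the balance equations with normalization
`π1 + ⋯ + π8 = 1` together with the correlation equations (6a)–(6h), and let
`Δ(μ3) = v_{10}(μ3) + ⋯ + v_{80}(μ3)`. Then `Δ(μ3) → Δ(λ, p, μ1, μ2, ρ)` as `μ3 → ∞`. -/
theorem aoi_tendsto_mean_field_aoi
    (lam mu1 mu2 p rho : ℝ)
    (hlam : 0 < lam) (hmu1 : 0 < mu1) (hmu2 : 0 < mu2)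
    (hp : 0 < p) (hp1 : p < 1) (hrho : 0 < rho)
    (π : ℝ → Fin 8 → ℝ) (v : ℝ → Fin 8 → Fin 4 → ℝ)
    (hsol : ∀ mu3 : ℝ, 0 < mu3 →
      (∀ i : Fin 8,
        bLHS lam (rho * mu3) mu1 mu2 mu3 (π mu3) i
          = bRHS lam (rho * mu3) mu1 mu2 mu3 p (π mu3) i) ∧
      (∑ i : Fin 8, π mu3 i = 1) ∧
      corrEq lam (rho * mu3) mu1 mu2 mu3 p (π mu3) (v mu3))
    (huniq : ∀ mu3 : ℝ, 0 < mu3 →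
      ∀ (π' : Fin 8 → ℝ) (v' : Fin 8 → Fin 4 → ℝ),
        (∀ i : Fin 8,
          bLHS lam (rho * mu3) mu1 mu2 mu3 π' i
            = bRHS lam (rho * mu3) mu1 mu2 mu3 p π' i) →
        (∑ i : Fin 8, π' i = 1) →
        corrEq lam (rho * mu3) mu1 mu2 mu3 p π' v' →
        π' = π mu3 ∧ v' = v mu3) :
    Filter.Tendsto (fun mu3 : ℝ => ∑ s : Fin 8, v mu3 s 0)
      Filter.atTop (nhds (mfAoI lam p mu1 mu2 rho)) := by
  obtain ⟨q, hqd⟩ : ∃ q, q = lam * (1 - p) := ⟨_, rfl⟩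
  obtain ⟨r, hrd⟩ : ∃ r, r = lam * p := ⟨_, rfl⟩
  have hq : 0 < q := by rw [hqd]; exact mul_pos hlam (by linarith)
  have hr : 0 < r := by rw [hrd]; positivity
  obtain ⟨A, hA⟩ : ∃ A, A = q / (lam + mu1) := ⟨_, rfl⟩
  obtain ⟨B, hB⟩ : ∃ B, B = r * A / (q + mu1) := ⟨_, rfl⟩
  obtain ⟨C, hC⟩ : ∃ C, C = 1 - A - B := ⟨_, rfl⟩
  obtain ⟨A1, hA1⟩ : ∃ A1, A1 = A / (lam + mu1) := ⟨_, rfl⟩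
  obtain ⟨B2, hB2⟩ : ∃ B2, B2 = B / (lam + mu1) := ⟨_, rfl⟩
  obtain ⟨B1, hB1⟩ : ∃ B1, B1 = (B + mu2 * B2 + r * A1) / (q + mu1 + mu2) := ⟨_, rfl⟩
  have key := fun (t : ℝ) (ht : 0 < t) =>
    ptw lam mu1 mu2 p (rho * t) t hlam hmu1 hmu2 hp hp1 (by positivity) ht A B C A1 B1 B2
      (π t) (v t) (by rw [hA, hqd]; field_simp) (by rw [hB, ← hqd, ← hrd]; field_simp) hC
      (by rw [hA1]; field_simp) (by rw [hB2]; field_simp)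
      (by rw [hB1, ← hqd, ← hrd]; field_simp) (hsol t ht).1 (hsol t ht).2.1 (hsol t ht).2.2
  simp only [← hqd, ← hrd] at key
  clear hsol huniq
  have cst : ∀ c : ℝ, Filter.Tendsto (fun _ : ℝ => c) Filter.atTop (nhds c) := fun c => tendsto_const_nhds
  have k1 := fun t ht => (key t ht).1
  have k2 := fun t ht => (key t ht).2.1
  have k3 := fun t ht => (key t ht).2.2.1
  have e_p4 := fun t ht => (key t ht).2.2.2.1
  have e_p1 := fun t ht => (key t ht).2.2.2.2.1
  have e_p3 := fun t ht => (key t ht).2.2.2.2.2.1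
  have e_p02 := fun t ht => (key t ht).2.2.2.2.2.2.1
  have e_v43 := fun t ht => (key t ht).2.2.2.2.2.2.2.1
  have e_v13 := fun t ht => (key t ht).2.2.2.2.2.2.2.2.1
  have e_v32 := fun t ht => (key t ht).2.2.2.2.2.2.2.2.2.1
  have e_v33 := fun t ht => (key t ht).2.2.2.2.2.2.2.2.2.2.1
  have e_v02 := fun t ht => (key t ht).2.2.2.2.2.2.2.2.2.2.2.1
  have e_v03 := fun t ht => (key t ht).2.2.2.2.2.2.2.2.2.2.2.2.1
  have e_d4 := fun t ht => (key t ht).2.2.2.2.2.2.2.2.2.2.2.2.2.1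
  have e_d1 := fun t ht => (key t ht).2.2.2.2.2.2.2.2.2.2.2.2.2.2.1
  have e_s2 := fun t ht => (key t ht).2.2.2.2.2.2.2.2.2.2.2.2.2.2.2.1
  have e_c2 := fun t ht => (key t ht).2.2.2.2.2.2.2.2.2.2.2.2.2.2.2.2.1
  have e_s0 := fun t ht => (key t ht).2.2.2.2.2.2.2.2.2.2.2.2.2.2.2.2.2.1
  have e_c0 := fun t ht => (key t ht).2.2.2.2.2.2.2.2.2.2.2.2.2.2.2.2.2.2.1
  have e_v673 := fun t ht => (key t ht).2.2.2.2.2.2.2.2.2.2.2.2.2.2.2.2.2.2.2.1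
  have e_v53 := fun t ht => (key t ht).2.2.2.2.2.2.2.2.2.2.2.2.2.2.2.2.2.2.2.2
  clear key
  -- small quantities
  have t_p4 := (sm hrho (cst (mu1 * A)) e_p4).2
  have t_p1 := (sm hrho (t_p4.const_mul q) e_p1).2
  have t_p3 := (sm hrho ((t_p4.const_mul r).add_const (mu1 * B)) e_p3).2
  have t_p02 := (sm hrho ((t_p3.const_mul q).add (t_p1.const_mul r)) e_p02).2
  have t_v43 := sm hrho (t_p4.add_const (mu1 * A1)) e_v43
  have t_v13 := sm hrho (t_p1.add (t_v43.2.const_mul q)) e_v13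
  have t_v32 := (sm hrho (t_p3.add_const (mu1 * B2)) e_v32).2
  have t_v33 := sm hrho (((t_p3.add (t_v43.2.const_mul r)).add
    (t_v32.const_mul mu2)).add_const (mu1 * B1)) e_v33
  have t_v02 := (sm hrho (t_p02.add (t_v32.const_mul q)) e_v02).2
  have t_v03 := sm hrho (((t_p02.add (t_v33.2.const_mul q)).add (t_v13.2.const_mul r)).add
    (t_v02.const_mul mu2)) e_v03
  -- component 2
  have hr1 : 0 < rho + 1 := by linarith
  have t_x := sm (n := fun _ => mu1) (x := fun t => mu1 / (lam + rho * t + t)) (c := lam) hr1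
    (cst mu1) (fun t ht => by field_simp; ring)
  have t_y := sm (n := fun _ => q) (x := fun t => q / (r + mu1 + rho * t + t)) (c := r + mu1) hr1
    (cst q) (fun t ht => by field_simp; ring)
  have t_K2 := t_x.1.mul t_y.2
  have f_d4 : ∀ t, 0 < t → v t 4 2 - v t 4 3 = mu1 / (lam + rho * t + t) *
      ((v t 0 2 + v t 1 2 + v t 6 2 + v t 2 2 + v t 7 2) - (A1 + B2)) := by
    intro t ht
    have := e_d4 t ht
    field_simp
    linear_combination this
  have f_d1 : ∀ t, 0 < t → v t 1 2 - v t 1 3 = q / (r + mu1 + rho * t + t) *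
      (mu1 / (lam + rho * t + t) *
      ((v t 0 2 + v t 1 2 + v t 6 2 + v t 2 2 + v t 7 2) - (A1 + B2))) := by
    intro t ht
    rw [← f_d4 t ht]
    have := e_d1 t ht
    rw [div_mul_eq_mul_div, eq_div_iff (by positivity)]
    linear_combination this
  have hS2 := cr2 (x := fun t => v t 0 2 + v t 1 2 + v t 6 2 + v t 2 2 + v t 7 2)
    (y := fun t => v t 3 2 + v t 4 2 + v t 5 2)
    (t_K2.const_add (r + mu1)) (cst (-q)) (t_x.1.sub_const mu1) (cst lam)
    ((t_K2.mul_const (A1 + B2)).const_add (A + B)) ((t_x.1.mul_const (A1 + B2)).const_add C)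
    (by
      have : (r + mu1 + mu1 / (rho + 1) * 0) * lam - -q * (mu1 / (rho + 1) - mu1)
        = lam * (r * (1 + rho) + mu1 + mu1 * p * rho) / (rho + 1) := by
        rw [hqd]; field_simp; ring
      rw [this]; positivity)
    (fun t ht => by
      have h1 := e_s2 t ht
      rw [f_d1 t ht] at h1
      linear_combination h1)
    (fun t ht => by
      have h1 := e_c2 t ht
      rw [f_d4 t ht] at h1
      linear_combination h1)
  obtain ⟨hS2, hC2⟩ := hS2
  obtain ⟨S2, hS2d⟩ : ∃ x, x = ((A + B + mu1 / (rho + 1) * 0 * (A1 + B2)) * lam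
    - -q * (C + mu1 / (rho + 1) * (A1 + B2))) /
    ((r + mu1 + mu1 / (rho + 1) * 0) * lam - -q * (mu1 / (rho + 1) - mu1)) := ⟨_, rfl⟩
  obtain ⟨C2, hC2d⟩ : ∃ x, x = ((r + mu1 + mu1 / (rho + 1) * 0) *
    (C + mu1 / (rho + 1) * (A1 + B2)) - (mu1 / (rho + 1) - mu1) *
    (A + B + mu1 / (rho + 1) * 0 * (A1 + B2))) /
    ((r + mu1 + mu1 / (rho + 1) * 0) * lam - -q * (mu1 / (rho + 1) - mu1)) := ⟨_, rfl⟩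
  rw [← hS2d] at hS2
  rw [← hC2d] at hC2
  have t_d4 : Filter.Tendsto (fun t => v t 4 2 - v t 4 3) Filter.atTop (nhds 0) := by
    have := t_x.2.mul (hS2.sub_const (A1 + B2))
    rw [zero_mul] at this
    refine this.congr' ?_
    filter_upwards [Filter.eventually_gt_atTop 0] with t ht
    exact (f_d4 t ht).symm
  have t_d1 : Filter.Tendsto (fun t => v t 1 2 - v t 1 3) Filter.atTop (nhds 0) := by
    have := t_y.2.mul t_d4
    rw [zero_mul] at this
    refine this.congr' ?_
    filter_upwards [Filter.eventually_gt_atTop 0] with t ht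
    rw [f_d1 t ht, f_d4 t ht]
  have t_v42 : Filter.Tendsto (fun t => v t 4 2) Filter.atTop (nhds 0) := by
    simpa using t_d4.add t_v43.2
  have t_v12 : Filter.Tendsto (fun t => v t 1 2) Filter.atTop (nhds 0) := by
    simpa using t_d1.add t_v13.2
  -- right-hand sides
  have t_P : Filter.Tendsto (fun t => π t 6 + π t 7 + mu2 * (v t 6 2 + v t 7 2)) Filter.atTop
      (nhds (A + B + mu2 * S2)) := by
    have := ((cst (A + B)).sub (t_p02.add t_p1)).add
      (((hS2.sub t_v02).sub t_v12).const_mul mu2)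
    simp only [add_zero, sub_zero] at this
    refine this.congr' ?_
    filter_upwards [Filter.eventually_gt_atTop 0] with t ht
    linear_combination - k1 t ht - k2 t ht
  have t_Q : Filter.Tendsto (fun t => π t 5 + mu2 * v t 5 2) Filter.atTop (nhds (C + mu2 * C2)) := by
    have := ((cst C).sub (t_p3.add t_p4)).add (((hC2.sub t_v32).sub t_v42).const_mul mu2)
    simp only [add_zero, sub_zero] at this
    refine this.congr' ?_
    filter_upwards [Filter.eventually_gt_atTop 0] with t ht
    linear_combination - k3 t ht
  have t_k1 : Filter.Tendsto (fun t => rho * t * (v t 0 3 + v t 2 3 + v t 1 3)) Filter.atTop (nhds 0) := by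
    have := (t_v03.1.add t_v13.1).const_mul rho
    simp only [mul_zero, add_zero, zero_div] at this
    refine this.congr (fun t => ?_)
    ring
  have t_k3 : Filter.Tendsto (fun t => rho * t * (v t 3 3 + v t 4 3)) Filter.atTop (nhds (mu1 * (A1 + B1))) := by
    have := (t_v33.1.add t_v43.1).const_mul rho
    simp only [mul_zero, add_zero, zero_add] at this
    have e : rho * (mu1 * B1 / rho + mu1 * A1 / rho) = mu1 * (A1 + B1) := by
      field_simp; ring
    rw [e] at this
    refine this.congr (fun t => ?_)
    ring
  -- component 0
  have t_eta : Filter.Tendsto (fun t : ℝ => (rho * t)⁻¹) Filter.atTop (nhds 0) :=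
    tendsto_inv_atTop_zero.comp (Filter.tendsto_id.const_mul_atTop hrho)
  have t_R := (((hS2.const_mul mu2).const_add (A + B)).const_mul rho).add t_k1
  have t_T := (((hC2.const_mul mu2).const_add C).const_mul rho).add t_k3
  have hdet2 : 0 < mu2 * (mu1 + mu2) * (1 + rho) + q * (mu1 + mu2 * (1 + rho)) := by positivity
  have hfin := cr2 (x := fun t => v t 0 0 + v t 1 0 + v t 6 0 + v t 2 0 + v t 7 0)
    (y := fun t => v t 3 0 + v t 4 0 + v t 5 0)
    (a := fun t => (mu1 + mu2) * (1 + rho)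
      + (rho * t)⁻¹ * (rho * (mu1 + mu2) ^ 2 + q * rho * mu1))
    (b := fun t => -q * (1 + rho)
      + (rho * t)⁻¹ * (-(rho * q * (mu1 + mu2)) - q * rho * (q + mu2)))
    (c := fun t => -(rho * mu1) + (rho * t)⁻¹ * (-(rho * mu1 * (q + mu2))))
    (d := fun t => (q + mu2) * (1 + rho) + (rho * t)⁻¹ * (rho * (q + mu2) ^ 2))
    ((t_eta.mul_const _).const_add _) ((t_eta.mul_const _).const_add _)
    ((t_eta.mul_const _).const_add _) ((t_eta.mul_const _).const_add _)
    ((t_P.add (t_R.mul ((t_eta.const_mul (mu1 + mu2)).const_add 1))).sub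
      ((t_eta.const_mul q).mul t_T))
    (t_Q.add (t_T.mul ((t_eta.const_mul (q + mu2)).const_add 1)))
    (by
      have : ((mu1 + mu2) * (1 + rho) + 0 * (rho * (mu1 + mu2) ^ 2 + q * rho * mu1)) *
          ((q + mu2) * (1 + rho) + 0 * (rho * (q + mu2) ^ 2)) -
          (-q * (1 + rho) + 0 * (-(rho * q * (mu1 + mu2)) - q * rho * (q + mu2))) *
          (-(rho * mu1) + 0 * (-(rho * mu1 * (q + mu2))))
          = (1 + rho) * (mu2 * (mu1 + mu2) * (1 + rho) + q * (mu1 + mu2 * (1 + rho))) := by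
        ring
      rw [this]; positivity)
    (fun t ht => by
      have h1 := e_s0 t ht
      have h2 := e_c0 t ht
      have h3 := e_v673 t ht
      have h4 := e_v53 t ht
      have h0 : rho * t * (rho * t)⁻¹ = 1 := mul_inv_cancel₀ (by positivity)
      linear_combination (1 + (mu1 + mu2) * (rho * t)⁻¹) * rho * h1 - q * (rho * t)⁻¹ * rho * h2 + h3
        + (-(mu1 + mu2) * ((v t 0 0 + v t 1 0 + v t 6 0 + v t 2 0 + v t 7 0) - (v t 6 3 + v t 7 3)) + q * ((v t 3 0 + v t 4 0 + v t 5 0) - v t 5 3)) * h0)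
    (fun t ht => by
      have h1 := e_s0 t ht
      have h2 := e_c0 t ht
      have h3 := e_v673 t ht
      have h4 := e_v53 t ht
      have h0 : rho * t * (rho * t)⁻¹ = 1 := mul_inv_cancel₀ (by positivity)
      linear_combination (1 + (q + mu2) * (rho * t)⁻¹) * rho * h2 + h4
        - (q + mu2) * ((v t 3 0 + v t 4 0 + v t 5 0) - v t 5 3) * h0)
  have hsum := hfin.1.add hfin.2
  refine Filter.Tendsto.congr (fun t => ?_) (hsum.mono_right (le_of_eq (congrArg nhds ?_)))
  · rw [Fin.sum_univ_eight]
    ring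
  clear hsum hfin t_R t_T t_P t_Q hS2 hC2
  have hlm : 0 < lam + mu1 := by positivity
  have hqr : lam = q + r := by rw [hqd, hrd]; ring
  have vS : A + B = q / (q + mu1) := by
    rw [hB, hA, hqr]; field_simp; ring
  have vC : C = mu1 / (q + mu1) := by
    have : C = 1 - (A + B) := by rw [hC]; ring
    rw [this, vS]; field_simp; ring
  have vU : A1 + B2 = q / ((q + mu1) * (lam + mu1)) := by
    have : A1 + B2 = (A + B) / (lam + mu1) := by rw [hA1, hB2]; ring
    rw [this, vS]; field_simp
  have vT : A1 + B1 = q * (lam + mu1 + mu2) / ((q + mu1) * (lam + mu1) * (q + mu1 + mu2)) := by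
    rw [hB1, hB2, hA1, hB, hA, hqr]; field_simp; ring
  obtain ⟨D1, hD1⟩ : ∃ D1, D1 = mu1 + r * (1 + rho) + mu1 * p * rho := ⟨_, rfl⟩
  have D1p : 0 < D1 := by rw [hD1]; positivity
  obtain ⟨D2, hD2⟩ : ∃ D2, D2 = mu2 * (mu1 + mu2) * (1 + rho) + q * (mu1 + mu2 * (1 + rho)) :=
    ⟨_, rfl⟩
  have D2p : 0 < D2 := by rw [hD2]; positivity
  have vd1 : (r + mu1 + mu1 / (rho + 1) * 0) * lam - -q * (mu1 / (rho + 1) - mu1)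
      = lam * D1 / (rho + 1) := by
    rw [hD1, hqd]; field_simp; ring
  have vd2 : ((mu1 + mu2) * (1 + rho) + 0 * (rho * (mu1 + mu2) ^ 2 + q * rho * mu1)) *
          ((q + mu2) * (1 + rho) + 0 * (rho * (q + mu2) ^ 2)) -
          (-q * (1 + rho) + 0 * (-(rho * q * (mu1 + mu2)) - q * rho * (q + mu2))) *
          (-(rho * mu1) + 0 * (-(rho * mu1 * (q + mu2)))) = (1 + rho) * D2 := by
    rw [hD2]; ring
  have vS2 : S2 = (q * lam * (1 + rho) * (lam + mu1)
      + q * (mu1 * (1 + rho) * (lam + mu1) + mu1 * q)) /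
      (lam * D1 * (q + mu1) * (lam + mu1)) := by
    rw [hS2d, vd1, vS, vC, vU]; field_simp; ring
  have vC2 : C2 = ((r + mu1) * (mu1 * (1 + rho) * (lam + mu1) + mu1 * q)
      + mu1 * rho * q * (lam + mu1)) /
      (lam * D1 * (q + mu1) * (lam + mu1)) := by
    rw [hC2d, vd1, vS, vC, vU]; field_simp; ring
  rw [vd2, vS, vC, vT, vS2, vC2]
  have vm : mfAoI lam p mu1 mu2 rho = ((1 + rho) / lam) *
    (lam ^ 3 * ((1 + rho) * p * (1 - p))
      + lam ^ 2 * (mu2 * (1 + rho) + mu1 * (1 + (2 - p) * p * rho))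
      + lam * ((1 + rho) * (mu1 + mu2) ^ 2 - mu1 ^ 2 * (1 - p) * rho)
      + mu1 * mu2 * (mu1 + mu2) * (1 + rho)) / (D1 * D2) := by
    rw [hD1, hD2, hqd, hrd]; rfl
  rw [vm]
  have hr' : r = lam - q := by rw [hqr]; ring
  field_simp
  rw [hD1, hrd, hqd]
  ring
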